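/- arXiv:1109.4544 — 2 statements merged into one kernel-verified Lean document; each statement's English description precedes it below -/
import Mathlib

section
/- Let E be a finite-dimensional real normed vector space and let Y_1, Y_2 be C² vector fields on E. With Z(q,v) = (v,0) and Y_i^V(q,v) = (0, Y_i(q)) on E × E, the identity [Y_1^V, [Z, Y_2^V]] = [Y_2^V, [Z, Y_1^V]] holds. -/
section VerticalLift

variable {E : Type*} [NormedAddCommGroup E] [NormedSpace ℝ E]

theorem HasFDerivAt.verticalLift {Y : E → E} {p : E × E} {Y' : E →L[ℝ] E}
    (h : HasFDerivAt Y Y' p.1) :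
    HasFDerivAt (fun p : E × E => ((0 : E), Y p.1))
      ((0 : E × E →L[ℝ] E).prod (Y'.comp (ContinuousLinearMap.fst ℝ E E))) p :=
  (hasFDerivAt_const (0 : E) p).prodMk (h.comp p hasFDerivAt_fst)

/-- The bracket of the flat geodesic spray with a vertical lift. -/
theorem lieBracket_spray_verticalLift {Y : E → E} (hY : Differentiable ℝ Y) :
    VectorField.lieBracket ℝ (fun p : E × E => (p.2, (0 : E)))
      (fun p : E × E => ((0 : E), Y p.1)) = fun p => (-Y p.1, fderiv ℝ Y p.1 p.2) := by
  ext1 p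
  have hZ : HasFDerivAt (fun p : E × E => (p.2, (0 : E)))
      ((ContinuousLinearMap.snd ℝ E E).prod (0 : E × E →L[ℝ] E)) p :=
    hasFDerivAt_snd.prodMk (hasFDerivAt_const (0 : E) p)
  rw [VectorField.lieBracket, (hY p.1).hasFDerivAt.verticalLift.fderiv, hZ.fderiv]
  simp

/-- The iterated bracket is the vertical lift of the symmetric product of the two fields. -/
theorem lieBracket_verticalLift_spray_verticalLift {Y₁ Y₂ : E → E} (hY₁ : Differentiable ℝ Y₁)
    (hY₂ : ContDiff ℝ 2 Y₂) :
    VectorField.lieBracket ℝ (fun p : E × E => ((0 : E), Y₁ p.1))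
      (VectorField.lieBracket ℝ (fun p : E × E => (p.2, (0 : E)))
        (fun p : E × E => ((0 : E), Y₂ p.1)))
      = fun p => ((0 : E), fderiv ℝ Y₂ p.1 (Y₁ p.1) + fderiv ℝ Y₁ p.1 (Y₂ p.1)) := by
  have hd : Differentiable ℝ Y₂ := hY₂.differentiable (by norm_num)
  have hd' : Differentiable ℝ (fderiv ℝ Y₂) :=
    (hY₂.fderiv_right (m := 1) (by norm_num)).differentiable (by norm_num)
  rw [lieBracket_spray_verticalLift hd]
  ext1 p
  have hW : HasFDerivAt (fun p : E × E => (-Y₂ p.1, fderiv ℝ Y₂ p.1 p.2)) _ p :=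
    ((hd p.1).hasFDerivAt.comp p hasFDerivAt_fst).neg.prodMk
      (((hd' p.1).hasFDerivAt.comp p hasFDerivAt_fst).clm_apply hasFDerivAt_snd)
  rw [VectorField.lieBracket, (hY₁ p.1).hasFDerivAt.verticalLift.fderiv, hW.fderiv]
  simp

end VerticalLift

/-- Symmetry of the symmetric product: `[Y₁^V, [Z, Y₂^V]] = [Y₂^V, [Z, Y₁^V]]`. -/
theorem stmt_11 {E : Type*} [NormedAddCommGroup E] [NormedSpace ℝ E] [FiniteDimensional ℝ E]
    (Y₁ Y₂ : E → E) (hY₁ : ContDiff ℝ 2 Y₁) (hY₂ : ContDiff ℝ 2 Y₂) :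
    VectorField.lieBracket ℝ (fun p : E × E => ((0 : E), Y₁ p.1))
      (VectorField.lieBracket ℝ (fun p : E × E => (p.2, (0 : E)))
        (fun p : E × E => ((0 : E), Y₂ p.1)))
      = VectorField.lieBracket ℝ (fun p : E × E => ((0 : E), Y₂ p.1))
          (VectorField.lieBracket ℝ (fun p : E × E => (p.2, (0 : E)))
            (fun p : E × E => ((0 : E), Y₁ p.1))) := by
  rw [lieBracket_verticalLift_spray_verticalLift (hY₁.differentiable (by norm_num)) hY₂,
    lieBracket_verticalLift_spray_verticalLift (hY₂.differentiable (by norm_num)) hY₁]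
  ext1 p
  rw [add_comm]
end

section
/- Let E be a finite-dimensional real normed vector space and let Y be a C² vector field on E. Define on E × E the vector fields Z(q,v) = (v,0) and Y^V(q,v) = (0, Y(q)). Then [Z, [Z, Y^V]](q,v) = (−2·DY_q(v), D²Y_q(v,v)) for all (q,v) ∈ E × E, where D²Y_q denotes the second Fréchet derivative of Y at q as a bilinear map. -/
/-- Bracket with the flat geodesic spray `Z(q,v) = (v,0)`:
`[Z, W](p) = DW_p(p.2, 0) − ((W p).2, 0)`. -/
theorem lieBracket_flatSpray {E : Type*} [NormedAddCommGroup E] [NormedSpace ℝ E]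
    {W : E × E → E × E} {p : E × E} {W' : E × E →L[ℝ] E × E} (hW : HasFDerivAt W W' p) :
    VectorField.lieBracket ℝ (fun p : E × E => (p.2, (0 : E))) W p
      = W' (p.2, 0) - ((W p).2, 0) := by
  have hZ : HasFDerivAt (fun p : E × E => (p.2, (0 : E)))
      ((ContinuousLinearMap.snd ℝ E E).prod 0) p :=
    hasFDerivAt_snd.prodMk (hasFDerivAt_const 0 p)
  simp [VectorField.lieBracket, hZ.fderiv, hW.fderiv]

/-- The bracket of the flat geodesic spray with a vertical lift:
`[Z, Y^V](q,v) = (−Y q, DY_q v)`. -/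
theorem lieBracket_flatSpray_verticalLift {E : Type*} [NormedAddCommGroup E] [NormedSpace ℝ E]
    {Y : E → E} (hY : Differentiable ℝ Y) :
    VectorField.lieBracket ℝ (fun p : E × E => (p.2, (0 : E)))
        (fun p : E × E => ((0 : E), Y p.1))
      = fun p => (-Y p.1, fderiv ℝ Y p.1 p.2) := by
  funext p
  have hW : HasFDerivAt (fun p : E × E => ((0 : E), Y p.1))
      ((0 : E × E →L[ℝ] E).prod ((fderiv ℝ Y p.1).comp (ContinuousLinearMap.fst ℝ E E))) p :=
    (hasFDerivAt_const 0 p).prodMk ((hY p.1).hasFDerivAt.comp p hasFDerivAt_fst)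
  simp [lieBracket_flatSpray hW]

/-- Flat-connection bracket formula: `[Z, [Z, Y^V]](q,v) = (−2·DY_q v, D²Y_q(v,v))`. -/
theorem stmt_12 {E : Type*} [NormedAddCommGroup E] [NormedSpace ℝ E] [FiniteDimensional ℝ E]
    (Y : E → E) (hY : ContDiff ℝ 2 Y) (q v : E) :
    VectorField.lieBracket ℝ (fun p : E × E => (p.2, (0 : E)))
      (VectorField.lieBracket ℝ (fun p : E × E => (p.2, (0 : E)))
        (fun p : E × E => ((0 : E), Y p.1))) (q, v)
      = (-(2 : ℝ) • fderiv ℝ Y q v, fderiv ℝ (fderiv ℝ Y) q v v) := by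
  have hd : Differentiable ℝ Y := hY.differentiable (by norm_num)
  have hd' : Differentiable ℝ (fderiv ℝ Y) :=
    (hY.fderiv_right (m := 1) (by norm_num)).differentiable (by norm_num)
  have hfst : HasFDerivAt (fun p : E × E => -Y p.1)
      (-(fderiv ℝ Y q).comp (ContinuousLinearMap.fst ℝ E E)) (q, v) :=
    ((hd q).hasFDerivAt.comp (q, v) hasFDerivAt_fst).neg
  have hD : HasFDerivAt (fun p : E × E => fderiv ℝ Y p.1)
      ((fderiv ℝ (fderiv ℝ Y) q).comp (ContinuousLinearMap.fst ℝ E E)) (q, v) :=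
    (hd' q).hasFDerivAt.comp (q, v) hasFDerivAt_fst
  rw [lieBracket_flatSpray_verticalLift hd,
    lieBracket_flatSpray (hfst.prodMk (hD.clm_apply hasFDerivAt_snd))]
  ext
  · simp only [Prod.fst_sub, ContinuousLinearMap.prod_apply, neg_apply,
      ContinuousLinearMap.comp_apply, ContinuousLinearMap.coe_fst']
    module
  · simp
end
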